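/- arXiv:2009.10655 — 6 statements merged into one kernel-verified Lean document; each statement's English description precedes it below -/
import Mathlib

section
/- For every positive integer n, the sequences P_n = (P_{n,k})_{k=0}^{n-1} and Q_n = (Q_{n,k})_{k=0}^{n-1} are strongly synchronised; in particular, both sequences are log-concave: for all 1 ≤ k ≤ n-2, (min(P_{n,k}, Q_{n,k}))^2 ≥ max(P_{n,k+1}, Q_{n,k+1}) · max(P_{n,k-1}, Q_{n,k-1}). -/
/-- Number of excedances of a permutation of `{1,…,n}` (encoded on `Fin n`):
`exc σ = |{i : σ(i) > i}|`. -/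
def excA {n : ℕ} (σ : Equiv.Perm (Fin n)) : ℕ :=
  (Finset.univ.filter (fun i : Fin n => i < σ i)).card

/-- `P n k`: number of even permutations of `[n]` with exactly `k` excedances. -/
def P (n k : ℕ) : ℕ :=
  (Finset.univ.filter (fun σ : Equiv.Perm (Fin n) =>
    Equiv.Perm.sign σ = 1 ∧ excA σ = k)).card

/-- `Q n k`: number of odd permutations of `[n]` with exactly `k` excedances. -/
def Q (n k : ℕ) : ℕ :=
  (Finset.univ.filter (fun σ : Equiv.Perm (Fin n) =>
    Equiv.Perm.sign σ = -1 ∧ excA σ = k)).card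

open scoped Finset

/-- The number of permutations of `Fin n` with sign `s` and exactly `k` excedances. -/
def signedExcCount (s : ℤˣ) (n k : ℕ) : ℕ :=
  #{σ : Equiv.Perm (Fin n) | Equiv.Perm.sign σ = s ∧ excA σ = k}

theorem card_symm_lt_eq_excA {n : ℕ} (e : Equiv.Perm (Fin n)) :
    #{j : Fin n | e.symm j < j} = excA e := by
  unfold excA
  symm
  refine Finset.card_bij (fun i _ => e i) ?_ ?_ ?_
  · simp
  · simp
  · intro j hj
    exact ⟨e.symm j, by simpa using hj, by simp⟩

theorem excA_eq_sum {n : ℕ} (e : Equiv.Perm (Fin n)) :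
    excA e = ∑ i, if i < e i then 1 else 0 := by
  rw [excA, Finset.card_filter]

theorem excA_decomposeFin_symm_zero {n : ℕ} (e : Equiv.Perm (Fin n)) :
    excA (Equiv.Perm.decomposeFin.symm (0, e)) = excA e := by
  rw [excA_eq_sum, excA_eq_sum, Fin.sum_univ_succ]
  simp only [Equiv.Perm.decomposeFin_symm_apply_zero, Equiv.Perm.decomposeFin_symm_apply_succ,
    lt_irrefl, if_false, zero_add, Equiv.swap_self, Equiv.refl_apply, Fin.succ_lt_succ_iff]

theorem excA_decomposeFin_symm_succ {n : ℕ} (e : Equiv.Perm (Fin n)) (j : Fin n) :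
    excA (Equiv.Perm.decomposeFin.symm (j.succ, e)) + (if e.symm j < j then 1 else 0)
      = excA e + 1 := by
  have key : (∑ i, if i.succ < Equiv.swap 0 j.succ (e i).succ then 1 else 0)
      + (if e.symm j < j then 1 else 0) = ∑ i, if i < e i then 1 else 0 := by
    rw [← Finset.add_sum_erase _ _ (Finset.mem_univ (e.symm j)),
      ← Finset.add_sum_erase (Finset.univ : Finset (Fin n)) (fun i => if i < e i then 1 else 0)
        (Finset.mem_univ (e.symm j))]
    have h : ∀ i ∈ Finset.univ.erase (e.symm j),
        (if i.succ < Equiv.swap 0 j.succ (e i).succ then 1 else 0) =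
          if i < e i then 1 else 0 := by
      intro i hi
      have hij : e i ≠ j := fun h => (Finset.ne_of_mem_erase hi) (by simp [← h])
      rw [Equiv.swap_apply_of_ne_of_ne (Fin.succ_ne_zero _) (by simpa using hij)]
      simp
    rw [Finset.sum_congr rfl h]
    simp [add_comm]
  rw [excA_eq_sum, excA_eq_sum, Fin.sum_univ_succ, ← key]
  simp
  ring

theorem signedExcCount_zero_right_succ (s : ℤˣ) (n : ℕ) :
    signedExcCount s (n + 1) 0 = signedExcCount s n 0 := by
  unfold signedExcCount
  rw [Finset.card_filter, Finset.card_filter, ← Equiv.sum_comp Equiv.Perm.decomposeFin.symm,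
    Fintype.sum_prod_type_right]
  refine Finset.sum_congr rfl fun e _ => ?_
  rw [Fin.sum_univ_succ]
  have h : ∀ j : Fin n, excA (Equiv.Perm.decomposeFin.symm (j.succ, e)) ≠ 0 := by
    intro j h0
    rw [excA_eq_sum, Fin.sum_univ_succ] at h0
    simp at h0
  simp [h, excA_decomposeFin_symm_zero]

theorem signedExcCount_succ_succ (s : ℤˣ) (n k : ℕ) :
    (signedExcCount s (n + 1) (k + 1) : ℤ) = signedExcCount s n (k + 1)
      + (k + 1) * signedExcCount (-s) n (k + 1) + (n - k) * signedExcCount (-s) n k := by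
  unfold signedExcCount
  simp only [Finset.card_filter]
  rw [← Equiv.sum_comp Equiv.Perm.decomposeFin.symm, Fintype.sum_prod_type_right]
  push_cast
  rw [Finset.mul_sum, Finset.mul_sum, ← Finset.sum_add_distrib, ← Finset.sum_add_distrib]
  refine Finset.sum_congr rfl fun e _ => ?_
  rw [Fin.sum_univ_succ]
  simp only [Equiv.Perm.decomposeFin.symm_sign, excA_decomposeFin_symm_zero, if_true,
    Fin.succ_ne_zero, if_false, one_mul, neg_mul, neg_eq_iff_eq_neg]
  rw [add_assoc]
  congr 1
  by_cases hs : Equiv.Perm.sign e = -s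
  · have hexc : (∑ j : Fin n, if e.symm j < j then (1 : ℤ) else 0) = excA e := by
      rw [← card_symm_lt_eq_excA e, Finset.card_filter]; push_cast; rfl
    have hj : ∀ j : Fin n,
        (if excA (Equiv.Perm.decomposeFin.symm (j.succ, e)) = k + 1 then (1 : ℤ) else 0) =
        (if e.symm j < j then 1 else 0) * (if excA e = k + 1 then 1 else 0) +
          (1 - if e.symm j < j then 1 else 0) * (if excA e = k then 1 else 0) := by
      intro j
      have := excA_decomposeFin_symm_succ e j
      split_ifs at this ⊢ <;> simp <;> omega
    simp only [hs, true_and, hj, Finset.sum_add_distrib, ← Finset.sum_mul,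
      Finset.sum_sub_distrib, hexc]
    split_ifs with h1 h2 h2 <;> simp [*]
    omega
  · simp [hs]

theorem signedExcCount_zero (s : ℤˣ) (k : ℕ) :
    signedExcCount s 0 k = if s = 1 ∧ k = 0 then 1 else 0 := by
  rw [signedExcCount, Finset.card_filter, Fintype.sum_unique]
  simp [excA, eq_comm]

/-- The larger of `P n k` and `Q n k` (see `excHi_sub_excLo`). -/
def excHi (n k : ℕ) : ℤ := signedExcCount ((-1) ^ k) n k

/-- The smaller of `P n k` and `Q n k` (see `excHi_sub_excLo`). -/
def excLo (n k : ℕ) : ℤ := signedExcCount (-(-1) ^ k) n k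

theorem excHi_succ_succ (n k : ℕ) : excHi (n + 1) (k + 1) =
    excHi n (k + 1) + (k + 1) * excLo n (k + 1) + (n - k) * excHi n k := by
  simp only [excHi, excLo, signedExcCount_succ_succ]
  simp [pow_succ]

theorem excLo_succ_succ (n k : ℕ) : excLo (n + 1) (k + 1) =
    excLo n (k + 1) + (k + 1) * excHi n (k + 1) + (n - k) * excLo n k := by
  simp only [excHi, excLo, signedExcCount_succ_succ]
  simp [pow_succ]

theorem excHi_succ_zero (n : ℕ) : excHi (n + 1) 0 = excHi n 0 := by
  simp [excHi, signedExcCount_zero_right_succ]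

theorem excLo_succ_zero (n : ℕ) : excLo (n + 1) 0 = excLo n 0 := by
  simp [excLo, signedExcCount_zero_right_succ]

theorem excHi_zero_zero : excHi 0 0 = 1 := by simp [excHi, signedExcCount_zero]

theorem excHi_zero_succ (k : ℕ) : excHi 0 (k + 1) = 0 := by simp [excHi, signedExcCount_zero]

theorem excLo_zero (k : ℕ) : excLo 0 k = 0 := by
  rcases k with _ | k <;> simp [excLo, signedExcCount_zero]

theorem excLo_nonneg (n k : ℕ) : 0 ≤ excLo n k := Int.natCast_nonneg _

theorem excHi_sub_excLo (n k : ℕ) : excHi (n + 1) k - excLo (n + 1) k = n.choose k := by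
  induction n generalizing k with
  | zero =>
    rcases k with _ | _ | k
    · simp [excHi_succ_zero, excLo_succ_zero, excHi_zero_zero, excLo_zero]
    all_goals simp [excHi_succ_succ, excLo_succ_succ, excHi_zero_succ, excLo_zero]
  | succ n ih =>
    rcases k with _ | k
    · simpa [excHi_succ_zero (n + 1), excLo_succ_zero (n + 1)] using ih 0
    · rw [excHi_succ_succ (n + 1), excLo_succ_succ (n + 1), Nat.choose_succ_succ]
      have h1 := ih (k + 1)
      have h2 := ih k
      have h3 : ((n.choose (k + 1) : ℤ)) * (k + 1) = n.choose k * (n - k) := by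
        rcases le_or_gt k n with h | h
        · have := Nat.choose_succ_right_eq n k
          zify [h] at this
          exact this
        · simp [Nat.choose_eq_zero_of_lt h, Nat.choose_eq_zero_of_lt (h.trans (Nat.lt_succ_self k))]
      push_cast
      linear_combination (-(k : ℤ)) * h1 + (n + 1 - k) * h2 - h3

theorem excLo_le_excHi (n k : ℕ) : excLo (n + 1) k ≤ excHi (n + 1) k := by
  have := excHi_sub_excLo n k
  omega

theorem excHi_nonneg (n k : ℕ) : 0 ≤ excHi n k := Int.natCast_nonneg _

theorem excHi_pos {n k : ℕ} (h : k ≤ n) : 0 < excHi (n + 1) k := by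
  have h1 := excHi_sub_excLo n k
  have h2 := Nat.choose_pos h
  have h3 := excLo_nonneg (n + 1) k
  omega

theorem excHi_eq_zero {n k : ℕ} (h : n < k) : excHi (n + 1) k = 0 := by
  induction n generalizing k with
  | zero =>
    rcases k with _ | _ | k
    · omega
    all_goals simp [excHi_succ_succ, excHi_zero_succ, excLo_zero]
  | succ n ih =>
    rcases k with _ | k
    · omega
    · have h1 := ih (k := k + 1) (by omega)
      have h2 := ih (k := k) (by omega)
      have h3 := excHi_sub_excLo n (k + 1)
      rw [Nat.choose_eq_zero_of_lt (by omega), h1] at h3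
      have h4 : excLo (n + 1) (k + 1) = 0 := by simpa using h3
      rw [excHi_succ_succ, h1, h2, h4]
      ring

/-- The inequality behind the inductive step. Here `z`, `(X, x)`, `(Y, y)`, `w` stand for four
consecutive entries of the sequences of larger and smaller values. -/
theorem strong_sync_step {a b X x Y y w z z' : ℤ} (ha : 1 ≤ a) (hb : 0 ≤ b) (hx : 0 ≤ x)
    (hxX : x ≤ X) (hy : 0 ≤ y) (hyY : y ≤ Y) (hw : 0 ≤ w) (hz : 0 ≤ z) (hzz' : z' ≤ z)
    (hXY : a * (X - x) = b * (Y - y)) (h1 : z * Y ≤ x ^ 2) (h2 : X * w ≤ y ^ 2)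
    (h3 : z * w ≤ x * y) :
    (z + (a + 1) * z' + b * X) * (Y + (a - 1) * y + (b + 2) * w) ≤
      (x + a * X + (b + 1) * y) ^ 2 := by
  obtain ⟨c, rfl⟩ : ∃ c, X = x + c := ⟨X - x, by ring⟩
  obtain ⟨d, rfl⟩ : ∃ d, Y = y + d := ⟨Y - y, by ring⟩
  have hc : 0 ≤ c := by linarith
  have hd : 0 ≤ d := by linarith
  obtain ⟨a, rfl⟩ : ∃ a', a = a' + 1 := ⟨a - 1, by ring⟩
  have ha' : 0 ≤ a := by linarith
  have hcd : (a + 1) * c = b * d := by linarith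
  have hX : 0 ≤ x + c := by linarith
  calc _ ≤ ((a + 3) * z + b * (x + c)) * (y + d + a * y + (b + 2) * w) := by
        gcongr
        · nlinarith
        · linarith
    _ = (a + 3) * (z * (y + d) + a * (z * y)) + (a + 3) * (b + 2) * (z * w)
        + b * (x + c) * (y + d + a * y) + b * (b + 2) * ((x + c) * w) := by ring
    _ ≤ (a + 3) * (x ^ 2 + a * x ^ 2) + (a + 3) * (b + 2) * (x * y)
        + b * (x + c) * (y + d + a * y) + b * (b + 2) * y ^ 2 := by
        have hzy : z * y ≤ x ^ 2 := le_trans (by gcongr) h1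
        gcongr
    _ ≤ _ := by
        have h1 : 0 ≤ (a + 1) * (2 * a + 3) * (x * c) := by positivity
        have h2 : 0 ≤ (a + 1) * (b + 2) * (y * c) := by positivity
        have h3 : 0 ≤ (a + 1) * a * c ^ 2 := by positivity
        linear_combination sq_nonneg (x - y) + h1 + h2 + h3 - (x + c) * hcd

theorem excHi_mul_excHi_le (n k : ℕ) :
    excHi (n + 1) (k + 2) * excHi (n + 1) k ≤ excLo (n + 1) (k + 1) ^ 2 := by
  induction n generalizing k with
  | zero => rw [excHi_eq_zero (by omega)]; nlinarith
  | succ n ih =>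
    rcases le_or_gt (n + 1) (k + 1) with hk | hk
    · rw [excHi_eq_zero (by omega)]; nlinarith
    have hXY : ((k + 1 : ℕ) : ℤ) * (excHi (n + 1) (k + 1) - excLo (n + 1) (k + 1)) =
        ((n - k : ℕ) : ℤ) * (excHi (n + 1) k - excLo (n + 1) k) := by
      rw [excHi_sub_excLo, excHi_sub_excLo]
      have := Nat.choose_succ_right_eq n k
      zify at this ⊢
      linarith
    have hnk : ((n - k : ℕ) : ℤ) = n - k := by omega
    have step := fun w hw => strong_sync_step (w := w) (by push_cast; omega) (Int.natCast_nonneg _)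
      (excLo_nonneg _ _) (excLo_le_excHi _ _) (excLo_nonneg _ _) (excLo_le_excHi _ _) hw
      (excHi_nonneg _ _) (excLo_le_excHi n (k + 2)) hXY (ih k)
    rw [hnk] at step
    push_cast at step
    rcases k with _ | k
    · have := step 0 le_rfl (by rw [mul_zero]; exact sq_nonneg _)
        (by rw [mul_zero]; exact mul_nonneg (excLo_nonneg _ _) (excLo_nonneg _ _))
      rw [excHi_succ_succ (n + 1), excLo_succ_succ (n + 1), excHi_succ_zero (n + 1)]
      convert this using 1 <;> push_cast <;> ring
    · have hX := excHi_pos (n := n) (k := k + 2) (by omega)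
      have hY := excHi_pos (n := n) (k := k + 1) (by omega)
      have h3 : excHi (n + 1) (k + 3) * excHi (n + 1) k ≤
          excLo (n + 1) (k + 2) * excLo (n + 1) (k + 1) := by
        have hpos := mul_pos hX hY
        have hXY' := mul_nonneg (excLo_nonneg (n + 1) (k + 2)) (excLo_nonneg (n + 1) (k + 1))
        have hle := mul_le_mul (excLo_le_excHi n (k + 2)) (excLo_le_excHi n (k + 1))
          (excLo_nonneg _ _) hX.le
        have hmul := mul_le_mul (ih (k + 1)) (ih k)
          (mul_nonneg (excHi_nonneg _ _) (excHi_nonneg _ _)) (sq_nonneg _)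
        refine le_of_mul_le_mul_right ?_ hpos
        linear_combination hmul + mul_le_mul_of_nonneg_left hle hXY'
      have := step _ (excHi_nonneg (n + 1) k) (ih k) h3
      rw [excHi_succ_succ (n + 1), excLo_succ_succ (n + 1), excHi_succ_succ (n + 1)]
      convert this using 1 <;> push_cast <;> ring

theorem P_eq_signedExcCount (n k : ℕ) : P n k = signedExcCount 1 n k := rfl

theorem Q_eq_signedExcCount (n k : ℕ) : Q n k = signedExcCount (-1) n k := rfl

theorem max_P_Q (n k : ℕ) : ((max (P (n + 1) k) (Q (n + 1) k) : ℕ) : ℤ) = excHi (n + 1) k := by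
  have h := excLo_le_excHi n k
  rw [P_eq_signedExcCount, Q_eq_signedExcCount]
  rcases Nat.even_or_odd k with hk | hk <;>
    simp only [excHi, excLo, hk.neg_one_pow, neg_neg] at h ⊢ <;> omega

theorem min_P_Q (n k : ℕ) : ((min (P (n + 1) k) (Q (n + 1) k) : ℕ) : ℤ) = excLo (n + 1) k := by
  have h := excLo_le_excHi n k
  rw [P_eq_signedExcCount, Q_eq_signedExcCount]
  rcases Nat.even_or_odd k with hk | hk <;>
    simp only [excHi, excLo, hk.neg_one_pow, neg_neg] at h ⊢ <;> omega

/-- **Theorem 5 (Type A).** For every positive integer `n`, the sequences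
`(P_{n,k})_{k=0}^{n-1}` and `(Q_{n,k})_{k=0}^{n-1}` are strongly synchronised (hence
log-concave): for all `1 ≤ k ≤ n-2`,
`(min(P_{n,k}, Q_{n,k}))² ≥ max(P_{n,k+1}, Q_{n,k+1}) · max(P_{n,k-1}, Q_{n,k-1})`. -/
theorem typeA_excedance_strongly_synchronised (n : ℕ) (hn : 1 ≤ n) :
    ∀ k : ℕ, 1 ≤ k → k ≤ n - 2 →
      (min (P n k) (Q n k)) ^ 2 ≥
        max (P n (k + 1)) (Q n (k + 1)) * max (P n (k - 1)) (Q n (k - 1)) := by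
  intro k hk _
  obtain ⟨n, rfl⟩ := Nat.exists_eq_add_of_le' hn
  obtain ⟨k, rfl⟩ := Nat.exists_eq_add_of_le' hk
  have h := excHi_mul_excHi_le n k
  rw [← max_P_Q, ← max_P_Q, ← min_P_Q] at h
  exact_mod_cast h
end

section
/- For every positive integer n, the sequences P^B_n = (P^B_{n,k})_{k=0}^{n} and Q^B_n = (Q^B_{n,k})_{k=0}^{n} are strongly synchronised: for all 1 ≤ k ≤ n-1, (min(P^B_{n,k}, Q^B_{n,k}))^2 ≥ max(P^B_{n,k+1}, Q^B_{n,k+1}) · max(P^B_{n,k-1}, Q^B_{n,k-1}). -/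
/-- An element of the hyperoctahedral group `B_n`, encoded as a pair `(σ, ε)` of a
permutation of `Fin n` and a sign vector: the corresponding signed permutation sends
`i+1` (for `i : Fin n`) to `±(σ(i)+1)`, and `-(i+1)` to `∓(σ(i)+1)`. -/
abbrev SignedPerm (n : ℕ) := Equiv.Perm (Fin n) × (Fin n → Bool)

/-- The value `π(i+1) ∈ {-n,…,-1,1,…,n}` of the signed permutation at `i+1`. -/
def valB {n : ℕ} (p : SignedPerm n) (i : Fin n) : ℤ :=
  if p.2 i then -((p.1 i : ℤ) + 1) else (p.1 i : ℤ) + 1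

/-- The signed permutation as a function on `ℤ` (value `0` outside `{-n,…,-1,1,…,n}`;
in particular `π(0) = 0`). -/
def appB {n : ℕ} (p : SignedPerm n) (x : ℤ) : ℤ :=
  if h : 1 ≤ x ∧ x ≤ (n : ℤ) then valB p ⟨x.toNat - 1, by omega⟩
  else if h' : 1 ≤ -x ∧ -x ≤ (n : ℤ) then -(valB p ⟨(-x).toNat - 1, by omega⟩)
  else 0

/-- Type B inversions:
`inv_B(π) = |{i<j : π(i)>π(j)}| + |{i<j : -π(i)>π(j)}| + |{i : π(i)<0}|`. -/
def invB {n : ℕ} (p : SignedPerm n) : ℕ :=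
  (Finset.univ.filter (fun ij : Fin n × Fin n =>
      ij.1 < ij.2 ∧ valB p ij.1 > valB p ij.2)).card +
  (Finset.univ.filter (fun ij : Fin n × Fin n =>
      ij.1 < ij.2 ∧ -valB p ij.1 > valB p ij.2)).card +
  (Finset.univ.filter (fun i : Fin n => valB p i < 0)).card

/-- Type B excedances (Brenti):
`exc_B(π) = |{i ∈ [n] : π(|π(i)|) > π(i)}| + |{i ∈ [n] : π(i) = -i}|`. -/
def excB {n : ℕ} (p : SignedPerm n) : ℕ :=
  (Finset.univ.filter (fun i : Fin n => appB p |valB p i| > valB p i)).card +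
  (Finset.univ.filter (fun i : Fin n => valB p i = -((i : ℤ) + 1))).card

/-- Type B descents (with the convention `π(0) = 0`):
`des_B(π) = |{i ∈ {0,…,n-1} : π(i) > π(i+1)}|`. -/
def desB {n : ℕ} (p : SignedPerm n) : ℕ :=
  (Finset.univ.filter (fun i : Fin n => appB p (i : ℤ) > appB p ((i : ℤ) + 1))).card

/-- `PB n k`: number of elements of `B_n^+` (even `inv_B`) with `k` type B excedances. -/
def PB (n k : ℕ) : ℕ :=
  (Finset.univ.filter (fun p : SignedPerm n => Even (invB p) ∧ excB p = k)).card

/-- `QB n k`: number of elements of `B_n^-` (odd `inv_B`) with `k` type B excedances. -/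
def QB (n k : ℕ) : ℕ :=
  (Finset.univ.filter (fun p : SignedPerm n => ¬ Even (invB p) ∧ excB p = k)).card

/-- `Bp n k`: number of elements of `B_n^+` with `k` type B descents. -/
def Bp (n k : ℕ) : ℕ :=
  (Finset.univ.filter (fun p : SignedPerm n => Even (invB p) ∧ desB p = k)).card

/-- `Bm n k`: number of elements of `B_n^-` with `k` type B descents. -/
def Bm (n k : ℕ) : ℕ :=
  (Finset.univ.filter (fun p : SignedPerm n => ¬ Even (invB p) ∧ desB p = k)).card

/-- The one-dimensional character `sign σ * (-1) ^ (number of minus signs)` of `B_n`. -/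
def signB {n : ℕ} (p : SignedPerm n) : ℤˣ :=
  Equiv.Perm.sign p.1 * ∏ i, if p.2 i then -1 else 1

/-- Whether position `i` contributes to `excB`, written in terms of the permutation of absolute
values and the signs of the two values adjacent to `i` in the cycle. -/
def IsExcB {n : ℕ} (p : SignedPerm n) (i : Fin n) : Prop :=
  if i < p.1 i then p.2 i = false else p.2 (p.1⁻¹ i) = true

instance {n : ℕ} (p : SignedPerm n) : DecidablePred (IsExcB p) := fun i => by
  unfold IsExcB; infer_instance

theorem appB_val_add_one {n : ℕ} (p : SignedPerm n) (i : Fin n) :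
    appB p ((i : ℤ) + 1) = valB p i := by
  have h : 1 ≤ (i : ℤ) + 1 ∧ (i : ℤ) + 1 ≤ n := by omega
  rw [appB, dif_pos h]
  congr 1

theorem abs_valB {n : ℕ} (p : SignedPerm n) (i : Fin n) : |valB p i| = (p.1 i : ℤ) + 1 := by
  unfold valB
  split_ifs
  · rw [abs_neg, abs_of_nonneg (by positivity)]
  · rw [abs_of_nonneg (by positivity)]

theorem excB_eq_card {n : ℕ} (p : SignedPerm n) :
    excB p = (Finset.univ.filter (IsExcB p)).card := by
  have h₁ : (Finset.univ.filter (fun i : Fin n => appB p |valB p i| > valB p i)).card =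
      (Finset.univ.filter
        (fun i : Fin n => valB p (p.1⁻¹ i) < valB p i)).card := by
    refine Finset.card_equiv p.1 fun i => ?_
    simp [abs_valB, appB_val_add_one]
  rw [excB, h₁, ← Finset.card_union_of_disjoint]
  · congr 1
    ext i
    simp only [Finset.mem_union, Finset.mem_filter, Finset.mem_univ, true_and]
    have hv : valB p (p.1⁻¹ i) = if p.2 (p.1⁻¹ i) then -((i : ℤ) + 1) else (i : ℤ) + 1 := by
      simp [valB]
    rw [hv]
    simp only [valB, IsExcB, Fin.lt_def]
    have hfix : (p.1 i : ℕ) = i → p.2 (p.1⁻¹ i) = p.2 i := fun h => by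
      rw [Equiv.Perm.inv_eq_iff_eq.2 (Fin.ext h).symm]
    by_cases h : (p.1 i : ℕ) = i
    · rw [hfix h]
      cases p.2 i <;> simp <;> omega
    · cases p.2 i <;> cases p.2 (p.1⁻¹ i) <;> simp <;> omega
  · rw [Finset.disjoint_filter]
    intro i _ h₁ h₂
    have hv := abs_valB p (p.1⁻¹ i)
    rw [h₂, lt_neg] at h₁
    rw [show p.1 (p.1⁻¹ i) = i from p.1.apply_symm_apply i] at hv
    have := neg_le_abs (valB p (p.1⁻¹ i))
    omega

theorem neg_one_pow_card_filter {ι : Type*} [Fintype ι] (q : ι → Prop) [DecidablePred q] :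
    (-1 : ℤˣ) ^ (Finset.univ.filter q).card = ∏ i, if q i then -1 else 1 := by
  simp [Finset.prod_ite]

theorem neg_one_pow_invB {n : ℕ} (p : SignedPerm n) : (-1 : ℤˣ) ^ invB p = signB p := by
  rw [invB, pow_add, pow_add]
  simp only [neg_one_pow_card_filter]
  rw [← Finset.prod_mul_distrib, signB, Equiv.Perm.sign_eq_prod_prod_Ioi, Fintype.prod_prod_type]
  congr 1
  · refine Finset.prod_congr rfl fun i _ => ?_
    have : Finset.Ioi i = Finset.univ.filter (fun j => i < j) := by ext; simp
    rw [this, Finset.prod_filter]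
    refine Finset.prod_congr rfl fun j _ => ?_
    by_cases hij : i < j
    · have hne : (p.1 i : ℕ) ≠ p.1 j := fun h => hij.ne (p.1.injective (Fin.ext h))
      simp only [hij, true_and, if_true, Fin.lt_def, valB]
      rcases hne.lt_or_gt with h | h <;> cases p.2 i <;> cases p.2 j <;>
        simp <;> split_ifs <;> first | rfl | omega
    · simp [hij]
  · refine Finset.prod_congr rfl fun i _ => ?_
    simp only [valB]
    by_cases h : p.2 i = true <;> simp [h] <;> omega

theorem even_invB_iff {n : ℕ} (p : SignedPerm n) : Even (invB p) ↔ signB p = 1 := by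
  rw [← neg_one_pow_invB]
  rcases Nat.even_or_odd (invB p) with h | h
  · simp [h]
  · simp [h.neg_one_pow, Nat.not_even_iff_odd.2 h]

/-- The number of signed permutations of sign `s` with `k` type B excedances. -/
def excCount (n : ℕ) (s : ℤˣ) (k : ℕ) : ℕ :=
  (Finset.univ.filter (fun p : SignedPerm n => signB p = s ∧ excB p = k)).card

theorem PB_eq_excCount (n k : ℕ) : PB n k = excCount n 1 k := by
  simp only [PB, excCount, even_invB_iff]

theorem QB_eq_excCount (n k : ℕ) : QB n k = excCount n (-1) k := by
  simp only [QB, excCount, even_invB_iff]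
  congr 1
  ext p
  rcases Int.units_eq_one_or (signB p) with h | h <;> simp [h]

theorem excB_le {n : ℕ} (p : SignedPerm n) : excB p ≤ n := by
  rw [excB_eq_card]
  exact (Finset.card_filter_le _ _).trans (by simp)

theorem excCount_eq_zero {n k : ℕ} (s : ℤˣ) (h : n < k) : excCount n s k = 0 := by
  rw [excCount, Finset.card_eq_zero, Finset.filter_eq_empty_iff]
  rintro p - ⟨-, hp⟩
  have := excB_le p
  omega

open Equiv in
/-- The permutation of `Fin (n + 1)` fixing the last element and acting as `σ` on the others. -/
def extendLast {n : ℕ} (σ : Perm (Fin n)) : Perm (Fin (n + 1)) :=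
  finSuccEquivLast.symm.permCongr (optionCongr σ)

theorem extendLast_castSucc {n : ℕ} (σ : Equiv.Perm (Fin n)) (i : Fin n) :
    extendLast σ i.castSucc = (σ i).castSucc := by
  simp [extendLast]

theorem extendLast_last {n : ℕ} (σ : Equiv.Perm (Fin n)) :
    extendLast σ (Fin.last n) = Fin.last n := by
  simp [extendLast]

theorem extendLast_inv_castSucc {n : ℕ} (σ : Equiv.Perm (Fin n)) (i : Fin n) :
    (extendLast σ)⁻¹ i.castSucc = (σ⁻¹ i).castSucc := by
  rw [Equiv.Perm.inv_eq_iff_eq, extendLast_castSucc]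
  simp

theorem extendLast_inv_last {n : ℕ} (σ : Equiv.Perm (Fin n)) :
    (extendLast σ)⁻¹ (Fin.last n) = Fin.last n := by
  rw [Equiv.Perm.inv_eq_iff_eq, extendLast_last]

theorem extendLast_injective {n : ℕ} :
    Function.Injective (extendLast : Equiv.Perm (Fin n) → Equiv.Perm (Fin (n + 1))) := by
  intro σ τ h
  ext i : 1
  have := congrArg (fun f => f i.castSucc) h
  simpa [extendLast_castSucc] using this

/-- Insertion of the largest value with sign `x` into the cycle structure of `p`, right after
position `j` (as a new cycle if `j` is the last position). -/
def insertLast {n : ℕ} (p : SignedPerm n) (x : Bool) (j : Fin (n + 1)) : SignedPerm (n + 1) :=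
  (extendLast p.1 * Equiv.swap (Fin.last n) j,
    Fin.snoc (α := fun _ => Bool) p.2 x ∘ Equiv.swap (Fin.last n) j)

theorem insertLast_injective {n : ℕ} :
    Function.Injective fun q : SignedPerm n × Bool × Fin (n + 1) =>
      insertLast q.1 q.2.1 q.2.2 := by
  rintro ⟨⟨σ, ε⟩, x, j⟩ ⟨⟨τ, δ⟩, y, k⟩ h
  obtain ⟨h₁, h₂⟩ := Prod.ext_iff.1 h
  simp only [insertLast] at h₁ h₂
  have hjk : j = k := by
    have hj := congrArg (fun f : Equiv.Perm _ => f⁻¹ (Fin.last n)) h₁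
    simpa [mul_inv_rev, extendLast_inv_last, -Equiv.Perm.coe_inv] using hj
  subst hjk
  have hσ : σ = τ := extendLast_injective (mul_right_cancel h₁)
  have hs := (Equiv.swap (Fin.last n) j).surjective.injective_comp_right h₂
  obtain ⟨hε, hx⟩ := Fin.snoc_inj.1 hs
  rw [hσ, hε, hx]

theorem insertLast_bijective {n : ℕ} :
    Function.Bijective fun q : SignedPerm n × Bool × Fin (n + 1) =>
      insertLast q.1 q.2.1 q.2.2 := by
  rw [Fintype.bijective_iff_injective_and_card]
  refine ⟨insertLast_injective, ?_⟩
  simp [Fintype.card_perm, Nat.factorial_succ, pow_succ]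
  ring

theorem signB_insertLast {n : ℕ} (p : SignedPerm n) (x : Bool) (j : Fin (n + 1)) :
    signB (insertLast p x j) =
      (if j = Fin.last n then 1 else -1) * (if x then -1 else 1) * signB p := by
  have h : ∏ i, (if (insertLast p x j).2 i then (-1 : ℤˣ) else 1) =
      (∏ i, if p.2 i then -1 else 1) * if x then -1 else 1 := by
    refine (Equiv.prod_comp (Equiv.swap (Fin.last n) j)
      (fun i => if Fin.snoc (α := fun _ => Bool) p.2 x i then (-1 : ℤˣ) else 1)).trans ?_
    rw [Fin.prod_univ_castSucc]
    simp
  rw [signB, h, signB]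
  simp only [insertLast, map_mul, Equiv.Perm.sign_swap', extendLast, Equiv.Perm.sign_permCongr,
    Equiv.optionCongr_sign, eq_comm (a := j)]
  ac_rfl

theorem insertLast_snd_inv {n : ℕ} (p : SignedPerm n) (x : Bool) (j i : Fin (n + 1)) :
    (insertLast p x j).2 ((insertLast p x j).1⁻¹ i) =
      Fin.snoc (α := fun _ => Bool) p.2 x ((extendLast p.1)⁻¹ i) := by
  simp [insertLast, mul_inv_rev, -Equiv.Perm.coe_inv]

theorem excB_eq_sum {n : ℕ} (p : SignedPerm n) :
    excB p = ∑ i, if IsExcB p i then 1 else 0 := by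
  rw [excB_eq_card, Finset.card_filter]

theorem excB_insertLast_last {n : ℕ} (p : SignedPerm n) (x : Bool) :
    excB (insertLast p x (Fin.last n)) = excB p + if x then 1 else 0 := by
  rw [excB_eq_sum, Fin.sum_univ_castSucc, excB_eq_sum]
  congr 1
  · refine Finset.sum_congr rfl fun i _ => ?_
    simp only [IsExcB, insertLast_snd_inv, extendLast_inv_castSucc, Fin.snoc_castSucc]
    simp [insertLast, extendLast_castSucc]
  · simp only [IsExcB, insertLast_snd_inv, extendLast_inv_last, Fin.snoc_last]
    simp [insertLast, extendLast_last]

theorem excB_insertLast_castSucc {n : ℕ} (p : SignedPerm n) (x : Bool) (a : Fin n) :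
    excB (insertLast p x a.castSucc) + (if IsExcB p a then 1 else 0) = excB p + 1 := by
  have hlast : IsExcB (insertLast p x a.castSucc) (Fin.last n) ↔ x = true := by
    simp only [IsExcB, insertLast_snd_inv, extendLast_inv_last, Fin.snoc_last]
    simp [insertLast, extendLast_castSucc, (Fin.le_last _).not_gt]
  have ha : IsExcB (insertLast p x a.castSucc) a.castSucc ↔ x = false := by
    simp only [IsExcB, insertLast_snd_inv]
    simp [insertLast, extendLast_last, Fin.castSucc_lt_last]
  have hne : ∀ i ≠ a, (IsExcB (insertLast p x a.castSucc) i.castSucc ↔ IsExcB p i) := by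
    intro i hi
    have hs : Equiv.swap (Fin.last n) a.castSucc i.castSucc = i.castSucc :=
      Equiv.swap_apply_of_ne_of_ne (Fin.castSucc_lt_last i).ne
        (fun h => hi (Fin.castSucc_injective n h))
    simp only [IsExcB, insertLast_snd_inv, extendLast_inv_castSucc, Fin.snoc_castSucc]
    simp [insertLast, hs, extendLast_castSucc]
  rw [excB_eq_sum, Fin.sum_univ_castSucc, excB_eq_sum,
    ← Finset.add_sum_erase _ _ (Finset.mem_univ a),
    ← Finset.add_sum_erase (a := a) _ (fun i => if IsExcB p i then 1 else 0) (Finset.mem_univ a),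
    Finset.sum_congr rfl fun i hi => if_congr (hne i (Finset.ne_of_mem_erase hi)) rfl rfl]
  simp only [ha, hlast]
  cases x <;> simp <;> ring

theorem excCount_succ_eq_sum (n : ℕ) (s : ℤˣ) (k : ℕ) :
    excCount (n + 1) s k = ∑ p : SignedPerm n, ∑ x : Bool, ∑ j : Fin (n + 1),
      if signB (insertLast p x j) = s ∧ excB (insertLast p x j) = k then 1 else 0 := by
  rw [excCount, Finset.card_filter, ← insertLast_bijective.sum_comp
    (fun p => if signB p = s ∧ excB p = k then 1 else 0), Fintype.sum_prod_type]
  simp only [Fintype.sum_prod_type]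

theorem sum_insertLast_castSucc {n : ℕ} (p : SignedPerm n) (s : ℤˣ) (k : ℕ) (a : Fin n) :
    (∑ x : Bool, if signB (insertLast p x a.castSucc) = s ∧
      excB (insertLast p x a.castSucc) = k then 1 else 0) =
      (if IsExcB p a then 1 else 0) * (if excB p = k then 1 else 0) +
      (if IsExcB p a then 0 else 1) * (if excB p + 1 = k then 1 else 0) := by
  have ht := excB_insertLast_castSucc p true a
  have hf := excB_insertLast_castSucc p false a
  simp only [Fintype.sum_bool, signB_insertLast, (Fin.castSucc_lt_last a).ne]
  by_cases ha : IsExcB p a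
  · simp only [ha, if_true, Nat.add_right_cancel_iff] at ht hf
    rcases Int.units_eq_one_or (signB p) with h | h <;>
      rcases Int.units_eq_one_or s with rfl | rfl <;> simp [h, ht, hf, ha]
  · simp only [ha, if_false, add_zero] at ht hf
    rcases Int.units_eq_one_or (signB p) with h | h <;>
      rcases Int.units_eq_one_or s with rfl | rfl <;> simp [h, ht, hf, ha]

theorem sum_insertLast {n : ℕ} (p : SignedPerm n) (s : ℤˣ) (k : ℕ) :
    (∑ x : Bool, ∑ j : Fin (n + 1),
      if signB (insertLast p x j) = s ∧ excB (insertLast p x j) = k then 1 else 0) =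
      (if signB p = s ∧ excB p = k then 1 else 0) +
      (if signB p = -s ∧ excB p + 1 = k then 1 else 0) +
      k * (if excB p = k then 1 else 0) +
      (n + 1 - k) * (if excB p + 1 = k then 1 else 0) := by
  have hcompl : (∑ a, if IsExcB p a then 0 else 1) = n - excB p := by
    rw [excB_eq_sum, eq_tsub_iff_add_eq_of_le (by rw [← excB_eq_sum]; exact excB_le p),
      ← Finset.sum_add_distrib]
    trans ∑ _a : Fin n, 1
    · exact Finset.sum_congr rfl fun a _ => by split_ifs <;> rfl
    · simp
  rw [Finset.sum_comm, Fin.sum_univ_castSucc,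
    Finset.sum_congr rfl fun a _ => sum_insertLast_castSucc p s k a, Finset.sum_add_distrib,
    ← Finset.sum_mul, ← Finset.sum_mul, ← excB_eq_sum, hcompl]
  simp only [Fintype.sum_bool, signB_insertLast, excB_insertLast_last, if_true, one_mul,
    Bool.false_eq_true, if_false, add_zero, neg_mul, neg_eq_iff_eq_neg]
  have h₁ : excB p * (if excB p = k then 1 else 0) = k * (if excB p = k then 1 else 0) := by
    split_ifs with h <;> simp [h]
  have h₂ : (n - excB p) * (if excB p + 1 = k then 1 else 0) =
      (n + 1 - k) * (if excB p + 1 = k then 1 else 0) := by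
    split_ifs with h
    · rw [← h, Nat.add_sub_add_right]
    · simp
  rw [h₁, h₂]
  ring

theorem sum_excB_eq (n : ℕ) (s : ℤˣ) (k : ℕ) :
    (∑ p : SignedPerm n, if excB p = k then 1 else 0) = excCount n s k + excCount n (-s) k := by
  rw [excCount, excCount, Finset.card_filter, Finset.card_filter, ← Finset.sum_add_distrib]
  refine Finset.sum_congr rfl fun p _ => ?_
  rcases Int.units_eq_one_or (signB p) with h | h <;>
    rcases Int.units_eq_one_or s with rfl | rfl <;> simp [h]

theorem excCount_succ_succ (n : ℕ) (s : ℤˣ) (k : ℕ) :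
    excCount (n + 1) s (k + 1) = excCount n s (k + 1) + excCount n (-s) k +
      (k + 1) * (excCount n s (k + 1) + excCount n (-s) (k + 1)) +
      (n - k) * (excCount n s k + excCount n (-s) k) := by
  rw [excCount_succ_eq_sum, Finset.sum_congr rfl fun p _ => sum_insertLast p s (k + 1)]
  simp only [Finset.sum_add_distrib, ← Finset.mul_sum, Nat.add_right_cancel_iff]
  rw [sum_excB_eq n s, sum_excB_eq n s, Nat.add_sub_add_right]
  simp only [excCount, Finset.card_filter]

theorem excCount_succ_zero (n : ℕ) (s : ℤˣ) : excCount (n + 1) s 0 = excCount n s 0 := by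
  rw [excCount_succ_eq_sum, Finset.sum_congr rfl fun p _ => sum_insertLast p s 0]
  rw [excCount, Finset.card_filter]
  simp

/-- The larger of the numbers of even and odd signed permutations with `k` excedances. -/
def maxCount (n k : ℕ) : ℕ := max (excCount n 1 k) (excCount n (-1) k)

/-- The smaller of the numbers of even and odd signed permutations with `k` excedances. -/
def minCount (n k : ℕ) : ℕ := min (excCount n 1 k) (excCount n (-1) k)

theorem minCount_le_maxCount (n k : ℕ) : minCount n k ≤ maxCount n k := min_le_max

theorem minCount_add_maxCount (n k : ℕ) :
    minCount n k + maxCount n k = excCount n 1 k + excCount n (-1) k := min_add_max _ _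

theorem maxCount_eq_zero {n k : ℕ} (h : n < k) : maxCount n k = 0 := by
  simp [maxCount, excCount_eq_zero _ h]

theorem maxCount_succ_zero (n : ℕ) : maxCount (n + 1) 0 = maxCount n 0 := by
  simp only [maxCount, excCount_succ_zero]

theorem maxCount_succ_succ_le (n k : ℕ) :
    maxCount (n + 1) (k + 1) ≤ maxCount n (k + 1) + maxCount n k +
      (k + 1) * (minCount n (k + 1) + maxCount n (k + 1)) +
      (n - k) * (minCount n k + maxCount n k) := by
  rw [minCount_add_maxCount, minCount_add_maxCount, maxCount, excCount_succ_succ,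
    excCount_succ_succ, neg_neg, add_comm (excCount n (-1) (k + 1)) (excCount n 1 (k + 1)),
    add_comm (excCount n (-1) k) (excCount n 1 k)]
  unfold maxCount
  omega

theorem le_minCount_succ_succ (n k : ℕ) :
    minCount n (k + 1) + minCount n k +
      (k + 1) * (minCount n (k + 1) + maxCount n (k + 1)) +
      (n - k) * (minCount n k + maxCount n k) ≤ minCount (n + 1) (k + 1) := by
  rw [minCount_add_maxCount, minCount_add_maxCount, minCount.eq_1 (n + 1), excCount_succ_succ,
    excCount_succ_succ, neg_neg, add_comm (excCount n (-1) (k + 1)) (excCount n 1 (k + 1)),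
    add_comm (excCount n (-1) k) (excCount n 1 k)]
  unfold minCount
  omega

theorem maxCount_le_maxCount_succ_succ (n k : ℕ) : maxCount n k ≤ maxCount (n + 1) (k + 1) := by
  unfold maxCount
  rw [excCount_succ_succ, excCount_succ_succ, neg_neg]
  omega

theorem maxCount_pos : ∀ {n k : ℕ}, k ≤ n → 0 < maxCount n k
  | 0, 0, _ => by decide
  | n + 1, 0, _ => by
    rw [maxCount_succ_zero]
    exact maxCount_pos n.zero_le
  | n + 1, k + 1, h =>
    (maxCount_pos (Nat.le_of_succ_le_succ h)).trans_le (maxCount_le_maxCount_succ_succ n k)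

theorem synchronised_step_aux {a b P p Q q : ℤ} (ha : 0 ≤ a) (hb : 0 ≤ b) (hp : 0 ≤ p) (hq : 0 ≤ q)
    (hpP : p ≤ P) (hqQ : q ≤ Q) :
    (2 * a + 1) * (2 * a + 5) * p ^ 2 + (2 * b + 1) * (2 * b + 5) * q ^ 2 +
      (2 * a + 5) * (2 * b + 5) * (p * q) + ((b + 1) * P + b * p) * ((a + 1) * Q + a * q) ≤
    ((a + 2) * p + (a + 1) * P + (b + 2) * q + (b + 1) * Q) ^ 2 := by
  obtain ⟨s, hs, rfl⟩ : ∃ s, 0 ≤ s ∧ P = p + s := ⟨P - p, by omega, by ring⟩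
  obtain ⟨t, ht, rfl⟩ : ∃ t, 0 ≤ t ∧ Q = q + t := ⟨Q - q, by omega, by ring⟩
  rw [← sub_nonneg]
  have h : 0 ≤ 4 * (p - q) ^ 2 + (10 * a * p * s + 2 * a * b * p * t + 3 * a * p * t +
      2 * a * b * q * s + a * b * s * t + 4 * a * q * s + a * s * t + 2 * a * s ^ 2 +
      4 * a ^ 2 * p * s + a ^ 2 * s ^ 2 + 6 * p * s + 4 * b * p * t + 5 * p * t + 3 * b * q * s +
      b * s * t + 5 * q * s + s * t + s ^ 2 + 10 * b * q * t + 2 * b * t ^ 2 + 4 * b ^ 2 * q * t +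
      b ^ 2 * t ^ 2 + 6 * q * t + t ^ 2) := by positivity
  linear_combination h

theorem synchronised_step {a b W P p Q q R X Y Z : ℤ} (ha : 0 ≤ a) (hb : 0 ≤ b)
    (hW : 0 ≤ W) (hR : 0 ≤ R) (hp : 0 ≤ p) (hq : 0 ≤ q) (hP : 0 < P) (hQ : 0 < Q)
    (hpP : p ≤ P) (hqQ : q ≤ Q) (h₁ : W * Q ≤ p ^ 2) (h₂ : P * R ≤ q ^ 2) (hY₀ : 0 ≤ Y)
    (hX : X ≤ (2 * a + 5) * W + (b + 1) * P + b * p)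
    (hY : Y ≤ (a + 1) * Q + a * q + (2 * b + 5) * R)
    (hZ : (a + 2) * p + (a + 1) * P + (b + 2) * q + (b + 1) * Q ≤ Z) :
    X * Y ≤ Z ^ 2 := by
  have h₃ : W * R ≤ p * q := by
    refine le_of_mul_le_mul_right ?_ (mul_pos hP hQ)
    calc W * R * (P * Q) = W * Q * (P * R) := by ring
      _ ≤ p ^ 2 * q ^ 2 := by gcongr
      _ = p * q * (p * q) := by ring
      _ ≤ p * q * (P * Q) := by gcongr
  have hWq : W * q ≤ p ^ 2 := (mul_le_mul_of_nonneg_left hqQ hW).trans h₁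
  have hpR : p * R ≤ q ^ 2 := (mul_le_mul_of_nonneg_right hpP hR).trans h₂
  calc X * Y ≤ ((2 * a + 5) * W + (b + 1) * P + b * p) *
        ((a + 1) * Q + a * q + (2 * b + 5) * R) :=
        mul_le_mul hX hY hY₀ (by positivity)
    _ = (2 * a + 5) * (a + 1) * (W * Q) + (2 * a + 5) * a * (W * q) +
        (2 * a + 5) * (2 * b + 5) * (W * R) + (2 * b + 5) * (b + 1) * (P * R) +
        (2 * b + 5) * b * (p * R) + ((b + 1) * P + b * p) * ((a + 1) * Q + a * q) := by ring
    _ ≤ (2 * a + 5) * (a + 1) * p ^ 2 + (2 * a + 5) * a * p ^ 2 +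
        (2 * a + 5) * (2 * b + 5) * (p * q) + (2 * b + 5) * (b + 1) * q ^ 2 +
        (2 * b + 5) * b * q ^ 2 + ((b + 1) * P + b * p) * ((a + 1) * Q + a * q) := by gcongr
    _ = (2 * a + 1) * (2 * a + 5) * p ^ 2 + (2 * b + 1) * (2 * b + 5) * q ^ 2 +
        (2 * a + 5) * (2 * b + 5) * (p * q) +
        ((b + 1) * P + b * p) * ((a + 1) * Q + a * q) := by ring
    _ ≤ ((a + 2) * p + (a + 1) * P + (b + 2) * q + (b + 1) * Q) ^ 2 :=
        synchronised_step_aux ha hb hp hq hpP hqQ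
    _ ≤ Z ^ 2 := by gcongr

theorem maxCount_mul_le_sq (n i : ℕ) :
    maxCount n (i + 2) * maxCount n i ≤ minCount n (i + 1) ^ 2 := by
  induction n generalizing i with
  | zero => simp [maxCount_eq_zero]
  | succ n ih =>
    rcases Nat.lt_or_ge n (i + 1) with hn | hn
    · simp [maxCount_eq_zero (n := n + 1) (k := i + 2) (by omega)]
    obtain ⟨b, rfl⟩ := Nat.exists_eq_add_of_le hn
    have hX := maxCount_succ_succ_le (i + 1 + b) (i + 1)
    have hZ := le_minCount_succ_succ (i + 1 + b) i
    have hw := minCount_le_maxCount (i + 1 + b) (i + 2)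
    have hpP := minCount_le_maxCount (i + 1 + b) (i + 1)
    have hqQ := minCount_le_maxCount (i + 1 + b) i
    have h₁ := ih i
    rw [show i + 1 + b - (i + 1) = b by omega] at hX
    rw [show i + 1 + b - i = b + 1 by omega] at hZ
    have hP := maxCount_pos (n := i + 1 + b) (k := i + 1) (by omega)
    have hQ := maxCount_pos (n := i + 1 + b) (k := i) (by omega)
    zify at hX hZ hw hpP hqQ h₁ hP hQ ⊢
    have hX' : (maxCount (i + 1 + b + 1) (i + 2) : ℤ) ≤
        (2 * i + 5) * maxCount (i + 1 + b) (i + 2) + (b + 1) * maxCount (i + 1 + b) (i + 1) +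
          b * minCount (i + 1 + b) (i + 1) := by
      have := mul_le_mul_of_nonneg_left hw (by positivity : (0 : ℤ) ≤ i + 2)
      linear_combination hX + this
    cases i with
    | zero =>
      refine synchronised_step (R := 0) (Nat.cast_nonneg 0) (Nat.cast_nonneg b)
        (Nat.cast_nonneg _) le_rfl (Nat.cast_nonneg _) (Nat.cast_nonneg _) hP hQ hpP hqQ h₁
        (by simp) (Nat.cast_nonneg _) hX' ?_ ?_
      · simp [maxCount_succ_zero]
      · linear_combination hZ
    | succ i =>
      have h₂ := ih i
      have hr := minCount_le_maxCount (i + 1 + 1 + b) i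
      have hY := maxCount_succ_succ_le (i + 1 + 1 + b) i
      rw [show i + 1 + 1 + b - i = b + 2 by omega] at hY
      zify at h₂ hr hY
      refine synchronised_step (R := maxCount (i + 1 + 1 + b) i) (Nat.cast_nonneg (i + 1))
        (Nat.cast_nonneg b) (Nat.cast_nonneg _) (Nat.cast_nonneg _) (Nat.cast_nonneg _)
        (Nat.cast_nonneg _) hP hQ hpP hqQ h₁ h₂ (Nat.cast_nonneg _) hX' ?_ ?_
      · have := mul_le_mul_of_nonneg_left hr (by positivity : (0 : ℤ) ≤ b + 2)
        push_cast
        linear_combination hY + this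
      · push_cast at hZ ⊢
        linear_combination hZ

/-- **Theorem 6 (Type B).** For every positive integer `n`, the sequences
`(P^B_{n,k})_{k=0}^{n}` and `(Q^B_{n,k})_{k=0}^{n}` are strongly synchronised:
for all `1 ≤ k ≤ n-1`,
`(min(P^B_{n,k}, Q^B_{n,k}))² ≥ max(P^B_{n,k+1}, Q^B_{n,k+1}) · max(P^B_{n,k-1}, Q^B_{n,k-1})`. -/
theorem typeB_excedance_strongly_synchronised (n : ℕ) (hn : 1 ≤ n) :
    ∀ k : ℕ, 1 ≤ k → k ≤ n - 1 →
      (min (PB n k) (QB n k)) ^ 2 ≥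
        max (PB n (k + 1)) (QB n (k + 1)) * max (PB n (k - 1)) (QB n (k - 1)) := by
  intro k hk _
  obtain ⟨i, rfl⟩ := Nat.exists_eq_add_of_le' hk
  simpa only [PB_eq_excCount, QB_eq_excCount, maxCount, minCount, Nat.add_sub_cancel, ge_iff_le]
    using maxCount_mul_le_sq n i
end

section
/- Let A = (a_k)_{k=0}^n and B = (b_k)_{k=0}^n be two nonnegative sequences with a_k ≤ b_k for all even k in [0,n] and a_k ≥ b_k for all odd k in [0,n]. Then the following are equivalent: (1) A is even log-concave and B is odd log-concave; (2) A and B are strongly synchronised. Similarly, if a_k ≥ b_k for all even k and a_k ≤ b_k for all odd k, then A is odd log-concave and B is even log-concave if and only if A and B are strongly synchronised. -/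
/-- If `a` lies below `b` at even indices and above it at odd indices, then each instance of the
strong synchronisation inequality is a log-concavity inequality of `a` (at even indices) or of `b`
(at odd indices). -/
theorem evenLogConcave_and_oddLogConcave_iff_stronglySynchronised (n : ℕ) (a b : ℕ → ℝ)
    (he : ∀ k ≤ n, Even k → a k ≤ b k) (ho : ∀ k ≤ n, Odd k → b k ≤ a k) :
    ((∀ k : ℕ, 1 ≤ k → k ≤ n - 1 → Even k → (a k) ^ 2 ≥ a (k - 1) * a (k + 1)) ∧
      (∀ k : ℕ, 1 ≤ k → k ≤ n - 1 → Odd k → (b k) ^ 2 ≥ b (k - 1) * b (k + 1))) ↔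
      (∀ k : ℕ, 1 ≤ k → k ≤ n - 1 →
        (min (a k) (b k)) ^ 2 ≥
          max (a (k + 1)) (b (k + 1)) * max (a (k - 1)) (b (k - 1))) := by
  have even_iff : ∀ k : ℕ, 1 ≤ k → k ≤ n - 1 → Even k →
      ((min (a k) (b k)) ^ 2 ≥ max (a (k + 1)) (b (k + 1)) * max (a (k - 1)) (b (k - 1)) ↔
        (a k) ^ 2 ≥ a (k - 1) * a (k + 1)) := by
    intro k h1 hn hk
    rw [min_eq_left (he k (by lia) hk), max_eq_left (ho (k + 1) (by lia) hk.add_one),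
      max_eq_left (ho (k - 1) (by lia) (Nat.Even.sub_odd h1 hk odd_one)), mul_comm]
  have odd_iff : ∀ k : ℕ, 1 ≤ k → k ≤ n - 1 → Odd k →
      ((min (a k) (b k)) ^ 2 ≥ max (a (k + 1)) (b (k + 1)) * max (a (k - 1)) (b (k - 1)) ↔
        (b k) ^ 2 ≥ b (k - 1) * b (k + 1)) := by
    intro k h1 hn hk
    rw [min_eq_right (ho k (by lia) hk), max_eq_right (he (k + 1) (by lia) hk.add_one),
      max_eq_right (he (k - 1) (by lia) (Nat.Odd.sub_odd hk odd_one)), mul_comm]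
  constructor
  · rintro ⟨ha, hb⟩ k h1 hn
    rcases Nat.even_or_odd k with hk | hk
    · exact (even_iff k h1 hn hk).2 (ha k h1 hn hk)
    · exact (odd_iff k h1 hn hk).2 (hb k h1 hn hk)
  · intro h
    exact ⟨fun k h1 hn hk => (even_iff k h1 hn hk).1 (h k h1 hn),
      fun k h1 hn hk => (odd_iff k h1 hn hk).1 (h k h1 hn)⟩


/-- **Theorem 11.** Let `A = (a_k)_{k=0}^n` and `B = (b_k)_{k=0}^n` be nonnegative
sequences. If `a_k ≤ b_k` for all even `k` and `a_k ≥ b_k` for all odd `k` (in `[0,n]`),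
then: `A` is even log-concave and `B` is odd log-concave if and only if `A` and `B`
are strongly synchronised. Similarly, if `a_k ≥ b_k` for all even `k` and `a_k ≤ b_k`
for all odd `k`, then: `A` is odd log-concave and `B` is even log-concave if and only if
`A` and `B` are strongly synchronised. -/
theorem ratio_alternating_strongly_synchronised_iff (n : ℕ) (a b : ℕ → ℝ)
    (ha : ∀ k ≤ n, 0 ≤ a k) (hb : ∀ k ≤ n, 0 ≤ b k) :
    ((∀ k ≤ n, Even k → a k ≤ b k) → (∀ k ≤ n, Odd k → b k ≤ a k) →
      (((∀ k : ℕ, 1 ≤ k → k ≤ n - 1 → Even k → (a k) ^ 2 ≥ a (k - 1) * a (k + 1)) ∧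
        (∀ k : ℕ, 1 ≤ k → k ≤ n - 1 → Odd k → (b k) ^ 2 ≥ b (k - 1) * b (k + 1))) ↔
        (∀ k : ℕ, 1 ≤ k → k ≤ n - 1 →
          (min (a k) (b k)) ^ 2 ≥
            max (a (k + 1)) (b (k + 1)) * max (a (k - 1)) (b (k - 1))))) ∧
    ((∀ k ≤ n, Even k → b k ≤ a k) → (∀ k ≤ n, Odd k → a k ≤ b k) →
      (((∀ k : ℕ, 1 ≤ k → k ≤ n - 1 → Odd k → (a k) ^ 2 ≥ a (k - 1) * a (k + 1)) ∧
        (∀ k : ℕ, 1 ≤ k → k ≤ n - 1 → Even k → (b k) ^ 2 ≥ b (k - 1) * b (k + 1))) ↔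
        (∀ k : ℕ, 1 ≤ k → k ≤ n - 1 →
          (min (a k) (b k)) ^ 2 ≥
            max (a (k + 1)) (b (k + 1)) * max (a (k - 1)) (b (k - 1))))) := by
  refine ⟨evenLogConcave_and_oddLogConcave_iff_stronglySynchronised n a b, fun he ho => ?_⟩
  rw [and_comm, evenLogConcave_and_oddLogConcave_iff_stronglySynchronised n b a he ho]
  simp only [min_comm, max_comm]
end

section
/- For every positive integer n and every 0 ≤ k ≤ n-1, P_{n,k} − Q_{n,k} = (−1)^k · C(n−1, k), where C(n−1, k) denotes the binomial coefficient (the difference taken in the integers). -/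
section

open Polynomial

/-- The matrix with entries `X` strictly below the diagonal and `1` elsewhere. -/
noncomputable def excMatrix (n : ℕ) : Matrix (Fin n) (Fin n) ℤ[X] :=
  fun i j => if j < i then X else 1

lemma det_excMatrix_eq_sum (n : ℕ) :
    (excMatrix n).det =
      ∑ σ : Equiv.Perm (Fin n), C ((Equiv.Perm.sign σ : ℤˣ) : ℤ) * X ^ excA σ := by
  rw [Matrix.det_apply']
  refine Finset.sum_congr rfl fun σ _ => ?_
  simp [excMatrix, excA, Finset.prod_ite]

lemma det_excMatrix_succ (m : ℕ) : (excMatrix (m + 1)).det = (1 - X) ^ m := by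
  let B : Matrix (Fin (m + 1)) (Fin (m + 1)) ℤ[X] :=
    fun i j => if j = 0 then excMatrix (m + 1) i 0 else if i = j then 1 - X else 0
  have hdet : (excMatrix (m + 1)).det = B.det := by
    refine Matrix.det_eq_of_forall_col_eq_smul_add_pred (fun _ => 1) (fun i => by simp [B]) ?_
    intro i j
    simp only [B, excMatrix, Fin.lt_def, Fin.ext_iff, Fin.val_succ, Fin.val_castSucc, Fin.val_zero]
    split_ifs <;> first | contradiction | omega | ring
  have htri : B.IsLowerTriangular := by
    intro i j hij
    have hij : i < j := hij
    simp [B, hij.ne, (Fin.zero_le i).trans_lt hij |>.ne']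
  rw [hdet, Matrix.det_of_isLowerTriangular B htri, Fin.prod_univ_succ]
  simp [B, excMatrix]

lemma coeff_one_sub_X_pow (m k : ℕ) :
    ((1 - X : ℤ[X]) ^ m).coeff k = (-1) ^ k * (m.choose k : ℤ) := by
  have h : (1 - X : ℤ[X]) ^ m = ((1 + X) ^ m).comp (C (-1) * X) := by
    simp [sub_eq_add_neg]
  rw [h, comp_C_mul_X_coeff, coeff_one_add_X_pow, mul_comm]

lemma P_sub_Q_eq_coeff_det (n k : ℕ) :
    (P n k : ℤ) - (Q n k : ℤ) = (excMatrix n).det.coeff k := by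
  simp only [P, Q, Finset.card_filter, Nat.cast_sum, ← Finset.sum_sub_distrib,
    det_excMatrix_eq_sum, finsetSum_coeff, coeff_C_mul, coeff_X_pow]
  refine Finset.sum_congr rfl fun σ _ => ?_
  rcases Int.units_eq_one_or (Equiv.Perm.sign σ) with h | h <;>
    simp [h, eq_comm (a := k), apply_ite Neg.neg]

end

/-- **Theorem (Mantaci).** For every positive integer `n` and every `0 ≤ k ≤ n-1`,
`P_{n,k} − Q_{n,k} = (−1)^k · C(n−1, k)` (in the integers). -/
theorem typeA_excedance_difference (n : ℕ) (hn : 1 ≤ n) (k : ℕ) (hk : k ≤ n - 1) :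
    (P n k : ℤ) - (Q n k : ℤ) = (-1) ^ k * (Nat.choose (n - 1) k : ℤ) := by
  obtain ⟨m, rfl⟩ := Nat.exists_eq_add_of_le' hn
  rw [P_sub_Q_eq_coeff_det, det_excMatrix_succ, coeff_one_sub_X_pow, Nat.add_sub_cancel]
end

section
/- For every positive integer n, the sequences (P_{n,k})_{k=0}^{n-1} and (Q_{n,k})_{k=0}^{n-1} are ratio-alternating; specifically, P_{n,k} ≥ Q_{n,k} for all even k with 0 ≤ k ≤ n-1, and P_{n,k} ≤ Q_{n,k} for all odd k with 0 ≤ k ≤ n-1. -/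
open Polynomial in
/-- The signed excedance enumerator of the permutations of `n + 1` letters is `(1 - X) ^ n`. -/
theorem sum_sign_mul_X_pow_excA (n : ℕ) :
    ∑ σ : Equiv.Perm (Fin (n + 1)), (Equiv.Perm.sign σ : ℤ) • (X : ℤ[X]) ^ excA σ =
      (1 - X) ^ n := by
  let A : Matrix (Fin (n + 1)) (Fin (n + 1)) ℤ[X] := fun a b => if b < a then X else 1
  let B : Matrix (Fin (n + 1)) (Fin (n + 1)) ℤ[X] := fun a b =>
    if b = 0 then A a 0 else if a = b then 1 - X else 0
  have hAB : A.det = B.det := by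
    refine Matrix.det_eq_of_forall_col_eq_smul_add_pred (fun _ => 1) (fun i => by simp [B]) ?_
    intro i j
    simp only [A, B, Fin.succ_ne_zero, if_false, one_mul]
    rcases lt_trichotomy i j.succ with h | rfl | h
    · have h' : i ≤ j.castSucc := Fin.le_castSucc_iff.2 h
      simp [h.ne, h.not_gt, h'.not_gt]
    · simp
    · have h' : j.castSucc < i := Fin.castSucc_lt_succ.trans h
      simp [h.ne', h, h']
  have hB : B.det = (1 - X) ^ n := by
    rw [Matrix.det_of_isLowerTriangular B, Fin.prod_univ_succ]
    · simp [A, B]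
    · intro i j hij
      have hij' : i < j := hij
      simp [B, hij'.ne, (Fin.zero_le i).trans_lt hij' |>.ne']
  rw [← hB, ← hAB, Matrix.det_apply]
  refine Finset.sum_congr rfl fun σ _ => ?_
  simp [A, excA, Finset.prod_ite, Units.smul_def]

theorem P_sub_Q_eq (n k : ℕ) :
    (P (n + 1) k : ℤ) - Q (n + 1) k = (-1) ^ k * n.choose k := by
  have h := congrArg (fun p => Polynomial.coeff p k) (sum_sign_mul_X_pow_excA n)
  have hc : ((1 - Polynomial.X : Polynomial ℤ) ^ n).coeff k = (-1) ^ k * n.choose k := by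
    have hp : (1 - Polynomial.X : Polynomial ℤ) ^ n =
        ((1 + Polynomial.X) ^ n).comp (Polynomial.C (-1) * Polynomial.X) := by
      simp [sub_eq_add_neg]
    rw [hp, Polynomial.comp_C_mul_X_coeff, Polynomial.coeff_one_add_X_pow, mul_comm]
  rw [← hc, ← h]
  simp only [Polynomial.finsetSum_coeff, Polynomial.coeff_smul, Polynomial.coeff_X_pow, P, Q,
    Finset.card_filter, Nat.cast_sum, ← Finset.sum_sub_distrib]
  refine Finset.sum_congr rfl fun σ _ => ?_
  rcases Int.units_eq_one_or (Equiv.Perm.sign σ) with hs | hs <;>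
    by_cases hk : excA σ = k <;> simp [hs, hk, eq_comm (a := k)]

/-- **Corollary.** For every positive integer `n`, the sequences `(P_{n,k})_{k=0}^{n-1}`
and `(Q_{n,k})_{k=0}^{n-1}` are ratio-alternating: `P_{n,k} ≥ Q_{n,k}` for even `k` and
`P_{n,k} ≤ Q_{n,k}` for odd `k` (for `0 ≤ k ≤ n-1`). -/
theorem typeA_excedance_ratio_alternating (n : ℕ) (hn : 1 ≤ n) :
    ∀ k : ℕ, k ≤ n - 1 →
      (Even k → Q n k ≤ P n k) ∧ (Odd k → P n k ≤ Q n k) := by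
  intro k _
  obtain ⟨m, rfl⟩ := Nat.exists_eq_add_of_le' hn
  have h := P_sub_Q_eq m k
  refine ⟨fun hk => ?_, fun hk => ?_⟩ <;> rw [hk.neg_one_pow] at h <;> lia
end

section
/- For every positive integer n and every 0 ≤ k ≤ n, B^+_{n,k} − B^-_{n,k} = (−1)^k · C(n, k), where C(n, k) denotes the binomial coefficient (the difference taken in the integers). -/
open Finset

section SignedPermutations

variable {n : ℕ}

lemma appB_zero (p : SignedPerm n) : appB p 0 = 0 := by
  simp [appB]

lemma appB_natCast_add_one (p : SignedPerm n) (i : Fin n) :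
    appB p ((i : ℤ) + 1) = valB p i := by
  have hi := i.isLt
  unfold appB
  rw [dif_pos (by omega)]
  congr 1

lemma appB_natCast (p : SignedPerm n) (i j : Fin n) (h : (i : ℕ) = j + 1) :
    appB p (i : ℤ) = valB p j := by
  rw [← appB_natCast_add_one, h]
  push_cast
  rfl

lemma valB_lt_zero_iff (p : SignedPerm n) (i : Fin n) : valB p i < 0 ↔ p.2 i = true := by
  unfold valB
  split_ifs with h <;> simp only [h, iff_true, iff_false, Bool.false_eq_true] <;> omega

/-- If the absolute value increases from one position to the next, then there is a descent
exactly when the second value is negative. -/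
lemma valB_lt_valB_iff_of_lt (p : SignedPerm n) {i j : Fin n} (h : p.1 i < p.1 j) :
    valB p j < valB p i ↔ p.2 j = true := by
  have h' : (p.1 i : ℕ) < p.1 j := h
  unfold valB
  split_ifs with h1 h2 h2 <;> simp only [h1, iff_true, iff_false, Bool.false_eq_true] <;> omega

lemma valB_lt_valB_iff_of_gt (p : SignedPerm n) {i j : Fin n} (h : p.1 j < p.1 i) :
    valB p j < valB p i ↔ p.2 i = false := by
  have h' : (p.1 j : ℕ) < p.1 i := h
  unfold valB
  split_ifs with h1 h2 h2 <;> simp [h2] <;> omega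

/-- Type B inversions have the parity of the inversions of the underlying permutation plus the
number of negative values. -/
lemma invB_eq (p : SignedPerm n) :
    invB p = #{ij : Fin n × Fin n | ij.1 < ij.2 ∧ p.1 ij.2 < p.1 ij.1} +
      2 * #{ij : Fin n × Fin n | ij.1 < ij.2 ∧ p.1 ij.1 < p.1 ij.2 ∧ p.2 ij.2 = true} +
      #{i : Fin n | p.2 i = true} := by
  unfold invB
  simp only [valB_lt_zero_iff]
  congr 1
  simp only [card_filter]
  rw [mul_sum, ← sum_add_distrib, ← sum_add_distrib]
  refine sum_congr rfl fun ij _ => ?_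
  obtain ⟨i, j⟩ := ij
  by_cases hij : i < j
  · have hne : (p.1 i : ℕ) ≠ p.1 j := fun h => hij.ne (p.1.injective (Fin.ext h))
    simp only [hij, true_and, valB, Fin.lt_def]
    cases p.2 i <;> cases p.2 j <;> simp <;> (try split_ifs) <;> omega
  · simp [hij]

lemma neg_one_pow_invB_s10 (p : SignedPerm n) :
    (-1 : ℤ) ^ invB p =
      (-1) ^ #{ij : Fin n × Fin n | ij.1 < ij.2 ∧ p.1 ij.2 < p.1 ij.1} *
        (-1) ^ #{i : Fin n | p.2 i = true} := by
  rw [invB_eq, pow_add, pow_add, pow_mul]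
  simp

/-- The signed permutation obtained by changing the sign of the value at position `q`. -/
def flipAt (q : Fin n) (ε : Fin n → Bool) : Fin n → Bool := Function.update ε q (!ε q)

lemma flipAt_self (q : Fin n) (ε : Fin n → Bool) : flipAt q ε q = !ε q := by simp [flipAt]

lemma flipAt_of_ne {q i : Fin n} (h : i ≠ q) (ε : Fin n → Bool) : flipAt q ε i = ε i := by
  simp [flipAt, h]

lemma flipAt_flipAt (q : Fin n) (ε : Fin n → Bool) : flipAt q (flipAt q ε) = ε := by
  simp [flipAt]

lemma flipAt_ne (q : Fin n) (ε : Fin n → Bool) : flipAt q ε ≠ ε := fun h => by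
  have := congrFun h q
  simp [flipAt_self] at this

lemma neg_one_pow_invB_flipAt (σ : Equiv.Perm (Fin n)) (q : Fin n) (ε : Fin n → Bool) :
    (-1 : ℤ) ^ invB ((σ, flipAt q ε) : SignedPerm n) =
      -(-1) ^ invB ((σ, ε) : SignedPerm n) := by
  have key : ∀ δ : Fin n → Bool, (-1 : ℤ) ^ #{i : Fin n | δ i = true} =
      (if δ q = true then -1 else 1) * ∏ i ∈ univ.erase q, if δ i = true then -1 else 1 := by
    intro δ
    rw [mul_prod_erase univ (fun i => if δ i = true then (-1 : ℤ) else 1) (mem_univ q),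
      prod_ite]
    simp
  have herase : (∏ i ∈ univ.erase q, if flipAt q ε i = true then (-1 : ℤ) else 1) =
      ∏ i ∈ univ.erase q, if ε i = true then (-1 : ℤ) else 1 :=
    prod_congr rfl fun i hi => by rw [flipAt_of_ne (ne_of_mem_erase hi)]
  rw [neg_one_pow_invB_s10, neg_one_pow_invB_s10, key, key ε, herase]
  simp only [flipAt_self]
  cases ε q <;> simp

/-- For a nonidentity permutation, let `m` be the least non-fixed point and `q` the position
of `m`: then every other position from `q - 1` on carries a value larger than `m`. -/
lemma exists_pos_forall_lt {σ : Equiv.Perm (Fin n)} (hσ : σ ≠ 1) :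
    ∃ q : Fin n, 0 < (q : ℕ) ∧ ∀ i : Fin n, i ≠ q → (q : ℕ) ≤ i + 1 → σ q < σ i := by
  have hne : {i : Fin n | σ i ≠ i}.Nonempty := by
    by_contra h
    rw [Set.not_nonempty_iff_eq_empty, Set.eq_empty_iff_forall_notMem] at h
    exact hσ (Equiv.ext fun i => by simpa using h i)
  obtain ⟨m, hm, hmin⟩ := WellFounded.has_min (wellFounded_lt (α := Fin n)) _ hne
  have hfix : ∀ i < m, σ i = i := fun i hi => by
    by_contra h
    exact hmin i h hi
  have hge : ∀ i, m ≤ i → m ≤ σ i := fun i hi => by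
    by_contra! h
    have := σ.injective (hfix _ h)
    rw [this] at h
    exact absurd hi (not_le.mpr h)
  have hq : σ (σ.symm m) = m := σ.apply_symm_apply m
  have hmq : m < σ.symm m := by
    by_contra! h
    rcases h.lt_or_eq with h | h
    · have := hfix _ h
      rw [hq] at this
      exact h.ne this.symm
    · rw [h] at hq
      exact hm hq
  refine ⟨σ.symm m, by rw [Fin.lt_def] at hmq; omega, fun i hi hqi => ?_⟩
  rw [hq]
  have hmi : m ≤ i := by rw [Fin.lt_def] at hmq; rw [Fin.le_def]; omega
  refine lt_of_le_of_ne (hge i hmi) fun h => hi ?_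
  rw [h, σ.symm_apply_apply]

lemma desB_flipAt {σ : Equiv.Perm (Fin n)} {q : Fin n} (hq : 0 < (q : ℕ))
    (hlt : ∀ i : Fin n, i ≠ q → (q : ℕ) ≤ i + 1 → σ q < σ i) (ε : Fin n → Bool) :
    desB ((σ, flipAt q ε) : SignedPerm n) = desB ((σ, ε) : SignedPerm n) := by
  unfold desB
  congr 1
  refine filter_congr fun i _ => ?_
  have hval : ∀ j, j ≠ q → valB ((σ, flipAt q ε) : SignedPerm n) j = valB (σ, ε) j :=
    fun j hj => by simp [valB, flipAt_of_ne hj]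
  rw [gt_iff_lt, gt_iff_lt, appB_natCast_add_one, appB_natCast_add_one]
  rcases Nat.eq_zero_or_pos (i : ℕ) with h0 | hpos
  · have hiq : i ≠ q := fun h => by rw [h] at h0; omega
    simp [h0, appB_zero, hval i hiq]
  · have hlt' := i.isLt
    have hj : (i : ℕ) = (⟨i - 1, by omega⟩ : Fin n) + 1 := by simp only; omega
    set j : Fin n := ⟨i - 1, by omega⟩
    rw [appB_natCast _ i j hj, appB_natCast _ i j hj]
    by_cases hiq : i = q
    · have hjq : j ≠ q := fun h => by rw [← hiq] at h; rw [← h] at hj; omega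
      have hσ : σ i < σ j := by rw [hiq]; exact hlt j hjq (by rw [← hiq]; omega)
      rw [valB_lt_valB_iff_of_gt _ hσ, valB_lt_valB_iff_of_gt _ hσ]
      simp [flipAt_of_ne hjq]
    · by_cases hjq : j = q
      · have hσ : σ j < σ i := by rw [hjq]; exact hlt i hiq (by rw [← hjq]; omega)
        rw [valB_lt_valB_iff_of_lt _ hσ, valB_lt_valB_iff_of_lt _ hσ]
        simp [flipAt_of_ne hiq]
      · rw [hval i hiq, hval j hjq]

lemma sum_signs_eq_zero {σ : Equiv.Perm (Fin n)} (hσ : σ ≠ 1) (k : ℕ) :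
    ∑ ε : Fin n → Bool, (if desB ((σ, ε) : SignedPerm n) = k then
      (-1 : ℤ) ^ invB ((σ, ε) : SignedPerm n) else 0) = 0 := by
  obtain ⟨q, hq, hlt⟩ := exists_pos_forall_lt hσ
  refine sum_involution (fun ε _ => flipAt q ε) (fun ε _ => ?_) (fun ε _ _ => flipAt_ne q ε)
    (fun _ _ => mem_univ _) (fun ε _ => flipAt_flipAt q ε)
  rw [desB_flipAt hq hlt, neg_one_pow_invB_flipAt]
  split_ifs <;> simp

lemma desB_one (ε : Fin n → Bool) :
    desB ((1, ε) : SignedPerm n) = #{i : Fin n | ε i = true} := by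
  unfold desB
  congr 1
  refine filter_congr fun i _ => ?_
  rw [gt_iff_lt, appB_natCast_add_one]
  rcases Nat.eq_zero_or_pos (i : ℕ) with h0 | hpos
  · simp [h0, appB_zero, valB_lt_zero_iff]
  · have hlt' := i.isLt
    have hj : (i : ℕ) = (⟨i - 1, by omega⟩ : Fin n) + 1 := by simp only; omega
    rw [appB_natCast _ i _ hj]
    refine valB_lt_valB_iff_of_lt _ ?_
    simp only [Equiv.Perm.coe_one, id_eq, Fin.lt_def]
    omega

lemma neg_one_pow_invB_one (ε : Fin n → Bool) :
    (-1 : ℤ) ^ invB ((1, ε) : SignedPerm n) = (-1) ^ #{i : Fin n | ε i = true} := by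
  have h : #{ij : Fin n × Fin n | ij.1 < ij.2 ∧
      ((1, ε) : SignedPerm n).1 ij.2 < ((1, ε) : SignedPerm n).1 ij.1} = 0 := by
    rw [card_eq_zero, filter_eq_empty_iff]
    exact fun _ _ h => lt_asymm h.1 h.2
  rw [neg_one_pow_invB_s10]
  rw [h, pow_zero, one_mul]

lemma card_filter_card_true_eq (k : ℕ) :
    #{ε : Fin n → Bool | #{i : Fin n | ε i = true} = k} = n.choose k := by
  have h : #(powersetCard k (univ : Finset (Fin n))) = n.choose k := by simp
  rw [← h]
  refine card_nbij' (fun ε => ({i : Fin n | ε i = true} : Finset (Fin n)))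
    (fun s i => decide (i ∈ s)) ?_ ?_ ?_ ?_
  · intro ε hε
    simpa [mem_powersetCard] using hε
  · intro s hs
    simpa [mem_powersetCard] using hs
  · intro ε _
    simp
  · intro s _
    simp

lemma sum_signs_one (n k : ℕ) :
    ∑ ε : Fin n → Bool, (if desB ((1, ε) : SignedPerm n) = k then
      (-1 : ℤ) ^ invB ((1, ε) : SignedPerm n) else 0) = (-1) ^ k * (n.choose k : ℤ) := by
  have : ∀ ε : Fin n → Bool, (if desB ((1, ε) : SignedPerm n) = k then
      (-1 : ℤ) ^ invB ((1, ε) : SignedPerm n) else 0) =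
      if #{i : Fin n | ε i = true} = k then (-1 : ℤ) ^ k else 0 := by
    intro ε
    rw [desB_one, neg_one_pow_invB_one]
    split_ifs with h
    · rw [h]
    · rfl
  rw [sum_congr rfl fun ε _ => this ε, ← sum_filter, sum_const, card_filter_card_true_eq,
    nsmul_eq_mul, mul_comm]

lemma Bp_sub_Bm (n k : ℕ) :
    (Bp n k : ℤ) - (Bm n k : ℤ) =
      ∑ p : SignedPerm n, if desB p = k then (-1 : ℤ) ^ invB p else 0 := by
  unfold Bp Bm
  simp only [card_filter]
  push_cast
  rw [← sum_sub_distrib]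
  refine sum_congr rfl fun p _ => ?_
  by_cases hk : desB p = k <;> rcases Nat.even_or_odd (invB p) with h | h
  · simp [hk, h, h.neg_one_pow]
  · simp [hk, h, h.neg_one_pow]
  · simp [hk]
  · simp [hk]

end SignedPermutations

/-- **Theorem (Reiner).** For every positive integer `n` and every `0 ≤ k ≤ n`,
`B⁺_{n,k} − B⁻_{n,k} = (−1)^k · C(n, k)` (in the integers). -/
theorem typeB_descent_difference (n : ℕ) (hn : 1 ≤ n) (k : ℕ) (hk : k ≤ n) :
    (Bp n k : ℤ) - (Bm n k : ℤ) = (-1) ^ k * (Nat.choose n k : ℤ) := by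
  rw [Bp_sub_Bm, Fintype.sum_prod_type,
    sum_eq_single 1 (fun σ _ hσ => sum_signs_eq_zero hσ k) (by simp), sum_signs_one]
end
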